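/- Let p, n be positive integers, let ξ : ℝ^p → ℝ^n be twice continuously differentiable with Jacobian J(θ), and suppose θ* ∈ ℝ^p satisfies ξ(θ*) = 0 and J(θ*) is injective. Fix γ ∈ (0,1) and define, on a neighborhood of θ* where H(θ) := J(θ)ᵀJ(θ) is invertible, the map T_GN(θ) := θ − γ · H(θ)⁻¹ J(θ)ᵀ ξ(θ). Then T_GN is differentiable at θ* and its Fréchet derivative at θ* equals (1 − γ) times the identity map on ℝ^p; in particular its operator norm is 1 − γ < 1. -/

import Mathlib

open ContinuousLinearMap

/-- The Gauss–Newton curvature `H(θ) = J(θ)ᵀ J(θ)` of a residual map `ξ`, where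
`J(θ) = Dξ(θ)` is the Fréchet derivative (Jacobian) of `ξ` at `θ`. -/
noncomputable def gnCurvature {p n : ℕ}
    (ξ : EuclideanSpace ℝ (Fin p) → EuclideanSpace ℝ (Fin n))
    (θ : EuclideanSpace ℝ (Fin p)) :
    EuclideanSpace ℝ (Fin p) →L[ℝ] EuclideanSpace ℝ (Fin p) :=
  (ContinuousLinearMap.adjoint (fderiv ℝ ξ θ)).comp (fderiv ℝ ξ θ)

/-- The damped Gauss–Newton map `T_GN(θ) = θ − γ H(θ)⁻¹ J(θ)ᵀ ξ(θ)`; the inverse is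
`Ring.inverse`, which equals the true inverse wherever `H(θ)` is invertible (in
particular on a neighborhood of a point where `H` is invertible). -/
noncomputable def dampedGN {p n : ℕ}
    (ξ : EuclideanSpace ℝ (Fin p) → EuclideanSpace ℝ (Fin n)) (γ : ℝ)
    (θ : EuclideanSpace ℝ (Fin p)) : EuclideanSpace ℝ (Fin p) :=
  θ - γ • (Ring.inverse (gnCurvature ξ θ)) (ContinuousLinearMap.adjoint (fderiv ℝ ξ θ) (ξ θ))

/-- If `A` is continuous at `x` and `f x = 0`, then `y ↦ A y (f y)` is differentiable at `x` as
soon as `f` is, with derivative `A x ∘ f'`. -/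
theorem HasFDerivAt.clm_apply_of_continuousAt {𝕜 E F G : Type*} [NontriviallyNormedField 𝕜]
    [NormedAddCommGroup E] [NormedSpace 𝕜 E] [NormedAddCommGroup F] [NormedSpace 𝕜 F]
    [NormedAddCommGroup G] [NormedSpace 𝕜 G] {f : E → F} {f' : E →L[𝕜] F} {x : E}
    {A : E → F →L[𝕜] G} (hf : HasFDerivAt f f' x) (hA : ContinuousAt A x) (hx : f x = 0) :
    HasFDerivAt (fun y => A y (f y)) ((A x).comp f') x := by
  have hdiff : (fun y => A y - A x) =o[nhds x] fun _ => (1 : ℝ) := by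
    rw [Asymptotics.isLittleO_one_iff]
    exact tendsto_sub_nhds_zero_iff.2 hA
  have happly : (fun y => (A y - A x) (f y)) =o[nhds x] fun y => y - x := by
    have hfO : f =O[nhds x] fun y => y - x := by simpa [hx] using hf.isBigO_sub
    refine Asymptotics.IsBigO.trans_isLittleO (g := fun y => ‖A y - A x‖ * ‖f y‖)
      (Asymptotics.isBigO_of_le _ fun y => ?_) ?_
    · simpa using (A y - A x).le_opNorm (f y)
    · simpa using hdiff.norm_left.mul_isBigO hfO.norm_norm
  have hzero : HasFDerivAt (fun y => (A y - A x) (f y)) (0 : E →L[𝕜] G) x :=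
    .of_isLittleO <| by simpa [hx] using happly
  have hsum := hzero.add ((A x).hasFDerivAt.comp x hf)
  rw [zero_add] at hsum
  exact hsum.congr_of_eventuallyEq (.of_forall fun y => by simp)

/-- The Gauss–Newton curvature is invertible where the Jacobian is injective. -/
theorem isUnit_gnCurvature {p n : ℕ} {ξ : EuclideanSpace ℝ (Fin p) → EuclideanSpace ℝ (Fin n)}
    {θ : EuclideanSpace ℝ (Fin p)} (hinj : Function.Injective (fderiv ℝ ξ θ)) :
    IsUnit (gnCurvature ξ θ) := by
  have hker : Function.Injective (gnCurvature ξ θ) := by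
    refine (injective_iff_map_eq_zero _).2 fun v hv => ?_
    refine (map_eq_zero_iff _ hinj).1 (inner_self_eq_zero (𝕜 := ℝ).1 ?_)
    rw [← ContinuousLinearMap.adjoint_inner_right]
    change inner ℝ v (gnCurvature ξ θ v) = 0
    rw [hv, inner_zero_right]
  rw [ContinuousLinearMap.isUnit_iff_bijective]
  exact ⟨hker, LinearMap.injective_iff_surjective (f := (gnCurvature ξ θ).toLinearMap) |>.1 hker⟩

/-- The Gauss–Newton curvature of a `C¹` residual map is continuous. -/
theorem continuous_gnCurvature {p n : ℕ}
    {ξ : EuclideanSpace ℝ (Fin p) → EuclideanSpace ℝ (Fin n)}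
    (hξ : Continuous (fderiv ℝ ξ)) : Continuous (gnCurvature ξ) :=
  (ContinuousLinearMap.adjoint.continuous.comp hξ).clm_comp hξ

/-- At a zero-residual point `θ*` with injective Jacobian, the damped
Gauss–Newton map `T_GN` is differentiable with Fréchet derivative `(1 − γ) · Id`; in
particular the operator norm of the derivative is `1 − γ < 1`. -/
theorem dampedGN_fderiv_at_solution
    (p n : ℕ) (hp : 0 < p) (hn : 0 < n)
    (ξ : EuclideanSpace ℝ (Fin p) → EuclideanSpace ℝ (Fin n))
    (hξ : ContDiff ℝ 2 ξ)
    (θs : EuclideanSpace ℝ (Fin p))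
    (hzero : ξ θs = 0)
    (hinj : Function.Injective (fderiv ℝ ξ θs))
    (γ : ℝ) (hγ : γ ∈ Set.Ioo (0 : ℝ) 1) :
    HasFDerivAt (dampedGN ξ γ)
      ((1 - γ) • ContinuousLinearMap.id ℝ (EuclideanSpace ℝ (Fin p))) θs ∧
    ‖(1 - γ) • ContinuousLinearMap.id ℝ (EuclideanSpace ℝ (Fin p))‖ = 1 - γ ∧
    ‖(1 - γ) • ContinuousLinearMap.id ℝ (EuclideanSpace ℝ (Fin p))‖ < 1 := by
  have hnorm : ‖(1 - γ) • ContinuousLinearMap.id ℝ (EuclideanSpace ℝ (Fin p))‖ = 1 - γ := by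
    have : Nonempty (Fin p) := ⟨⟨0, hp⟩⟩
    rw [norm_smul, ContinuousLinearMap.norm_id, mul_one, Real.norm_of_nonneg (by linarith [hγ.2])]
  refine ⟨?_, hnorm, by linarith [hγ.1]⟩
  have hJ : Continuous (fderiv ℝ ξ) := hξ.continuous_fderiv (by norm_num)
  have hunit := isUnit_gnCurvature hinj
  have hinv : ContinuousAt (fun θ => Ring.inverse (gnCurvature ξ θ)) θs := by
    obtain ⟨u, hu⟩ := hunit
    exact ContinuousAt.comp (g := Ring.inverse) (hu ▸ NormedRing.inverse_continuousAt u)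
      (continuous_gnCurvature hJ).continuousAt
  have hA : ContinuousAt (fun θ => (Ring.inverse (gnCurvature ξ θ)).comp
      (ContinuousLinearMap.adjoint (fderiv ℝ ξ θ))) θs :=
    hinv.clm_comp (ContinuousLinearMap.adjoint.continuous.comp hJ).continuousAt
  have hstep := ((hξ.differentiable (by norm_num)) θs).hasFDerivAt.clm_apply_of_continuousAt
    hA hzero
  have hid : ((Ring.inverse (gnCurvature ξ θs)).comp
      (ContinuousLinearMap.adjoint (fderiv ℝ ξ θs))).comp (fderiv ℝ ξ θs) =
      ContinuousLinearMap.id ℝ _ := Ring.inverse_mul_cancel _ hunit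
  rw [hid] at hstep
  refine ((hasFDerivAt_id θs).sub (hstep.const_smul γ)).congr_fderiv ?_
  ext1 v
  simp [_root_.sub_smul]
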